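/- Let k ≥ 3 and 0 < γ < 1/4^{k−1}. There exist constants c > 0 and R₀ (depending only on k and γ) such that for every R ≥ R₀ and N = ⌈20(2k)^{k/2}⌉·R there exists a function ζ : {−1,1}^{NR} → ℝ satisfying: (i) ζ(x) = 0 for every x ∈ {−1,1}^{NR} with Hamming weight |x| > N; (ii) Σ_{x ∈ D, |x| ≤ N} ζ(x)·f(x) − Σ_{x ∉ D, |x| ≤ N} |ζ(x)| > 2/3, where f = GapOR_R^γ ∘ THR_N^k with domain D; (iii) ‖ζ‖₁ = 1; and (iv) ζ has pure high degree at least c·√(N^{1−1/k})/(ln N)². -/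

import Mathlib

open Finset
open scoped Classical

/-- `toSign b` is the real ±1-value encoded by the Boolean `b`, with `true ↦ −1`. -/
noncomputable def toSign (b : Bool) : ℝ := if b then -1 else 1

/-- Hamming weight: the number of coordinates equal to −1 (encoded by `true`). -/
def wt {n : ℕ} (x : Fin n → Bool) : ℕ := (Finset.univ.filter (fun i => x i = true)).card

/-- Hamming weight of an input of `{−1,1}^{NR}`, given as `R` blocks of length `N`. -/
def wt2 {N R : ℕ} (x : Fin R → Fin N → Bool) : ℕ :=
  (Finset.univ.filter (fun p : Fin R × Fin N => x p.1 p.2 = true)).card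

/-- `THR_N^k(x) = −1` (i.e. `true`) iff `|x| ≥ k`. -/
def THR (N k : ℕ) (x : Fin N → Bool) : Bool := decide (k ≤ wt x)

/-- The domain of `f = GapOR_R^γ ∘ THR_N^k`. -/
def inDom (γ : ℝ) (N R k : ℕ) (x : Fin R → Fin N → Bool) : Prop :=
  (∀ i, THR N k (x i) = false) ∨
    γ * R ≤ ((Finset.univ.filter (fun i => THR N k (x i) = true)).card : ℝ)

/-- The value of `f = GapOR_R^γ ∘ THR_N^k` on its domain. -/
noncomputable def fval (N R k : ℕ) (x : Fin R → Fin N → Bool) : ℝ :=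
  if ∀ i, THR N k (x i) = false then 1 else -1

lemma prod_erase_abs_sub {k j : ℕ} (hj : j ≤ k) :
    ∏ r ∈ (range (k + 1)).erase j, |(j : ℝ) - r| = (j.factorial : ℝ) * (k - j).factorial := by
  induction k, hj using Nat.le_induction with
  | base =>
    rw [range_add_one, erase_insert (by simp), ← prod_range_reflect, ← prod_range_add_one_eq_factorial]
    simp only [Nat.sub_self, Nat.factorial_zero, Nat.cast_one, mul_one, Nat.cast_prod]
    refine prod_congr rfl fun r hr => ?_
    have h := mem_range.1 hr
    rw [show j - 1 - r = j - (r + 1) by omega, Nat.cast_sub h]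
    rw [abs_of_nonneg (by push_cast; linarith [(Nat.cast_nonneg r : (0 : ℝ) ≤ r)])]
    push_cast; ring
  | succ k hk ih =>
    rw [range_add_one, erase_insert_of_ne (by omega), prod_insert (by simp), ih,
      show k + 1 - j = (k - j) + 1 by omega, Nat.factorial_succ]
    have h : ((k - j : ℕ) : ℝ) = k - j := Nat.cast_sub hk
    have hk' : (j : ℝ) ≤ k := by exact_mod_cast hk
    rw [abs_of_nonpos (by push_cast; linarith)]
    push_cast
    rw [h]; ring

lemma prod_sq_ratio {d i : ℕ} (hi : i + 1 ≤ d) :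
    ∏ l ∈ (range d).erase i, (((l : ℝ) + 1) ^ 2 / |((i : ℝ) + 1) ^ 2 - ((l : ℝ) + 1) ^ 2|) =
      2 * (d.factorial : ℝ) ^ 2 / ((d - (i + 1)).factorial * (d + (i + 1)).factorial) := by
  induction d, hi using Nat.le_induction with
  | base =>
    rw [range_add_one, erase_insert (by simp)]
    have h1 : ∏ l ∈ range i, ((l : ℝ) + 1) = i.factorial := by
      rw [← prod_range_add_one_eq_factorial]; push_cast; rfl
    have h2 : ∏ l ∈ range i, ((i : ℝ) - l) = i.factorial := by
      rw [← h1, ← prod_range_reflect]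
      refine prod_congr rfl fun r hr => ?_
      have h := mem_range.1 hr
      rw [show i - 1 - r = i - (r + 1) by omega, Nat.cast_sub h]
      push_cast; ring
    have h3 : (∏ l ∈ range i, ((i : ℝ) + l + 2)) * (i + 1).factorial = (2 * i + 1).factorial := by
      have := Nat.factorial_mul_ascFactorial (i + 1) i
      rw [Nat.ascFactorial_eq_prod_range] at this
      rw [show 2 * i + 1 = i + 1 + i by ring, ← this]
      push_cast
      rw [mul_comm]
      congr 1
      exact prod_congr rfl fun r _ => by ring
    have h4 : ∏ l ∈ range i, (((l : ℝ) + 1) ^ 2 / |((i : ℝ) + 1) ^ 2 - ((l : ℝ) + 1) ^ 2|) =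
        ∏ l ∈ range i, ((((l : ℝ) + 1) ^ 2) / (((i : ℝ) - l) * ((i : ℝ) + l + 2))) := by
      refine prod_congr rfl fun r hr => ?_
      have h : (r : ℝ) ≤ i := by exact_mod_cast (mem_range.1 hr).le
      rw [abs_of_nonneg (by nlinarith [(Nat.cast_nonneg r : (0 : ℝ) ≤ r)])]
      congr 1; ring
    have hp : (i.factorial : ℝ) ≠ 0 := by positivity
    have hp' : ((i + 1).factorial : ℝ) ≠ 0 := by positivity
    have hq : ∏ l ∈ range i, ((i : ℝ) + l + 2) ≠ 0 := by
      refine prod_ne_zero_iff.2 fun r _ => by positivity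
    rw [h4, prod_div_distrib, prod_mul_distrib, prod_pow, h1, h2]
    rw [show i + 1 + (i + 1) = (2 * i + 1) + 1 by ring, Nat.factorial_succ (2 * i + 1)]
    push_cast
    rw [← h3, Nat.factorial_succ i]
    simp only [Nat.sub_self, Nat.factorial_zero]
    push_cast
    field_simp
    ring
  | succ d hd ih =>
    rw [range_add_one, erase_insert_of_ne (by omega), prod_insert (by simp), ih,
      show d + 1 - (i + 1) = (d - (i + 1)) + 1 by omega,
      show d + 1 + (i + 1) = (d + (i + 1)) + 1 by omega]
    simp only [Nat.factorial_succ]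
    have h : ((d - (i + 1) : ℕ) : ℝ) = d - (i + 1) := by
      rw [Nat.cast_sub hd]; push_cast; ring
    have hk' : (i : ℝ) + 1 ≤ d := by exact_mod_cast hd
    rw [abs_of_nonpos (by nlinarith [(Nat.cast_nonneg i : (0 : ℝ) ≤ i)])]
    have e : -(((i : ℝ) + 1) ^ 2 - ((d : ℝ) + 1) ^ 2) = (d - i) * (d + i + 2) := by ring
    rw [e]
    push_cast
    rw [h]
    have : (d : ℝ) - i ≠ 0 := by linarith
    have h2 : (d : ℝ) - (i + 1) + 1 ≠ 0 := by linarith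
    have h3 : (d : ℝ) + i + 2 ≠ 0 := by positivity
    field_simp
    ring

lemma factorial_sq_div_le {d i : ℕ} (hi : i ≤ d) :
    (d.factorial : ℝ) ^ 2 / ((d - i).factorial * (d + i).factorial) ≤
      Real.exp (-((i : ℝ) ^ 2 / (2 * d))) := by
  induction i with
  | zero =>
    simp only [Nat.sub_zero, Nat.add_zero]
    have : (d.factorial : ℝ) ≠ 0 := by positivity
    simp; field_simp; simp
  | succ i ih =>
    have ih := ih (by omega)
    have hd : (i : ℝ) + 1 ≤ d := by exact_mod_cast hi
    have hi0 : (0 : ℝ) ≤ i := Nat.cast_nonneg i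
    have h1 : (d.factorial : ℝ) ^ 2 / ((d - (i + 1)).factorial * (d + (i + 1)).factorial) =
        (d.factorial : ℝ) ^ 2 / ((d - i).factorial * (d + i).factorial) *
          (((d : ℝ) - i) / (d + i + 1)) := by
      rw [show d - i = (d - (i + 1)) + 1 by omega, show d + (i + 1) = (d + i) + 1 by omega,
        Nat.factorial_succ, Nat.factorial_succ]
      have h : ((d - (i + 1) : ℕ) : ℝ) = d - (i + 1) := by
        rw [Nat.cast_sub hi]; push_cast; ring
      push_cast
      rw [h]
      have h2 : (d : ℝ) - (i + 1) + 1 ≠ 0 := by linarith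
      field_simp
      ring
    have h2 : ((d : ℝ) - i) / (d + i + 1) ≤ Real.exp (-((2 * i + 1) / (2 * d))) := by
      refine le_trans ?_ (Real.add_one_le_exp _)
      rw [div_le_iff₀ (by positivity)]
      have : (2 * (i : ℝ) + 1) / (2 * d) * (d + i + 1) ≤ 2 * i + 1 := by
        rw [div_mul_eq_mul_div, div_le_iff₀ (by linarith)]
        nlinarith
      nlinarith
    rw [h1]
    calc _ ≤ Real.exp (-((i : ℝ) ^ 2 / (2 * d))) * Real.exp (-((2 * i + 1) / (2 * d))) := by
            gcongr
            exact div_nonneg (by linarith) (by positivity)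
      _ = _ := by rw [← Real.exp_add]; congr 1; push_cast; ring

/-- The support of the block dual polynomial: `0, …, k` together with the dilated squares
`a, 4a, …, d²a`. -/
def blockNodes (k a d : ℕ) : Finset ℕ :=
  range (k + 1) ∪ (range d).image (fun i => a * (i + 1) ^ 2)

/-- Lagrange weights on `blockNodes`, scaled so that the weight of `k` is one. -/
noncomputable def blockDual (k a d t : ℕ) : ℝ :=
  (∏ r ∈ (blockNodes k a d).erase k, ((k : ℝ) - r)) /
    ∏ r ∈ (blockNodes k a d).erase t, ((t : ℝ) - r)

lemma square_node_injective {a : ℕ} (ha : 0 < a) :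
    Function.Injective (fun i : ℕ => a * (i + 1) ^ 2) := by
  intro i j h
  have h := Nat.eq_of_mul_eq_mul_left ha h
  have := Nat.pow_left_injective (n := 2) (by norm_num) h
  omega

lemma lt_square_node {k a : ℕ} (ha : k < a) (i : ℕ) : k < a * (i + 1) ^ 2 :=
  lt_of_lt_of_le ha (Nat.le_mul_of_pos_right a (by positivity))

lemma blockNodes_disjoint {k a : ℕ} (ha : k < a) (d : ℕ) :
    Disjoint (range (k + 1)) ((range d).image (fun i => a * (i + 1) ^ 2)) := by
  rw [disjoint_left]
  intro t ht hh
  obtain ⟨i, -, rfl⟩ := mem_image.1 hh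
  have := lt_square_node ha i
  have := mem_range.1 ht
  omega

lemma sum_blockNodes {k a : ℕ} (ha : k < a) (d : ℕ) (f : ℕ → ℝ) :
    ∑ t ∈ blockNodes k a d, f t =
      ∑ t ∈ range (k + 1), f t + ∑ i ∈ range d, f (a * (i + 1) ^ 2) := by
  rw [blockNodes, sum_union (blockNodes_disjoint ha d),
    sum_image (square_node_injective (by omega)).injOn]

lemma prod_blockNodes_erase_small {k a j : ℕ} (ha : k < a) (hj : j ≤ k) (d : ℕ) (f : ℕ → ℝ) :
    ∏ t ∈ (blockNodes k a d).erase j, f t =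
      (∏ t ∈ (range (k + 1)).erase j, f t) * ∏ i ∈ range d, f (a * (i + 1) ^ 2) := by
  rw [blockNodes, erase_union_distrib, erase_eq_of_notMem (s := (range d).image _),
    prod_union ((blockNodes_disjoint ha d).mono_left (erase_subset _ _)),
    prod_image (square_node_injective (by omega)).injOn]
  intro h
  obtain ⟨i, -, h⟩ := mem_image.1 h
  have := lt_square_node ha i
  omega

lemma prod_blockNodes_erase_square {k a i : ℕ} (ha : k < a) (d : ℕ) (f : ℕ → ℝ) :
    ∏ t ∈ (blockNodes k a d).erase (a * (i + 1) ^ 2), f t =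
      (∏ t ∈ range (k + 1), f t) * ∏ l ∈ (range d).erase i, f (a * (l + 1) ^ 2) := by
  have hinj := square_node_injective (show 0 < a by omega)
  rw [blockNodes, erase_union_distrib, erase_eq_of_notMem (s := range (k + 1)),
    ← image_erase hinj,
    prod_union ((blockNodes_disjoint ha d).mono_right (image_subset_image (erase_subset _ _))),
    prod_image hinj.injOn]
  intro h
  have := lt_square_node ha i
  have := mem_range.1 h
  omega

lemma card_blockNodes {k a : ℕ} (ha : k < a) (d : ℕ) : (blockNodes k a d).card = k + 1 + d := by
  rw [blockNodes, card_union_of_disjoint (blockNodes_disjoint ha d),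
    card_image_of_injective _ (square_node_injective (by omega)), card_range, card_range]

lemma sum_blockDual_mul_eval {k a d : ℕ} (hk : 1 ≤ k) (ha : k < a) (q : Polynomial ℝ)
    (hq : q.natDegree ≤ d) :
    ∑ t ∈ blockNodes k a d, blockDual k a d t * q.eval (t : ℝ) = 0 := by
  have hc := card_blockNodes ha d
  have h := Lagrange.coeff_eq_sum (s := blockNodes k a d) (v := fun t : ℕ => (t : ℝ))
    Nat.cast_injective.injOn (P := q)
    (lt_of_le_of_lt Polynomial.degree_le_natDegree (by exact_mod_cast (by omega)))
  rw [Polynomial.coeff_eq_zero_of_natDegree_lt (by omega)] at h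
  calc _ = (∏ r ∈ (blockNodes k a d).erase k, ((k : ℝ) - r)) *
      ∑ t ∈ blockNodes k a d, q.eval (t : ℝ) / ∏ r ∈ (blockNodes k a d).erase t, ((t : ℝ) - r) := by
        rw [mul_sum]
        exact sum_congr rfl fun t _ => by unfold blockDual; ring
    _ = 0 := by rw [← h, mul_zero]

lemma blockDual_self (k a d : ℕ) : blockDual k a d k = 1 := by
  refine div_self (prod_ne_zero_iff.2 fun r hr => sub_ne_zero.2 ?_)
  exact_mod_cast (ne_of_mem_erase hr).symm

lemma abs_blockDual_small_le {k a j : ℕ} (ha : k < a) (hj : j ≤ k) (d : ℕ) :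
    |blockDual k a d j| ≤ k.choose j := by
  have hkj : (j : ℝ) ≤ k := by exact_mod_cast hj
  have hnode : ∀ i : ℕ, (k : ℝ) < (a * (i + 1) ^ 2 : ℕ) := fun i => by
    exact_mod_cast lt_square_node ha i
  rw [blockDual, abs_div, abs_prod, abs_prod, prod_blockNodes_erase_small ha le_rfl,
    prod_blockNodes_erase_small ha hj, prod_erase_abs_sub le_rfl, prod_erase_abs_sub hj,
    Nat.choose_eq_factorial_div_factorial hj, mul_div_mul_comm]
  rw [Nat.cast_div (Nat.factorial_mul_factorial_dvd_factorial hj) (by positivity)]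
  push_cast
  simp only [Nat.sub_self, Nat.factorial_zero, Nat.cast_one, mul_one]
  refine mul_le_of_le_one_right (by positivity) ?_
  rw [← prod_div_distrib]
  refine prod_le_one (fun i _ => by positivity) fun i _ => ?_
  have := hnode i
  push_cast at this
  refine div_le_one_of_le₀ ?_ (abs_nonneg _)
  rw [abs_of_nonpos (by linarith), abs_of_nonpos (by linarith)]
  linarith

lemma abs_blockDual_square_le {k a d i : ℕ} (hk : 3 ≤ k) (ha : 2 * k ≤ a) (hi : i < d) :
    |blockDual k a d (a * (i + 1) ^ 2)| ≤
      (k.factorial * 2 ^ (k + 2) / (a : ℝ) ^ k) *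
        (Real.exp (-(((i : ℝ) + 1) ^ 2 / (2 * d))) / ((i : ℝ) + 1) ^ 2) := by
  have hka : k < a := by omega
  have haR : 2 * (k : ℝ) ≤ a := by exact_mod_cast ha
  have hkR : (3 : ℝ) ≤ k := by exact_mod_cast hk
  have ha0 : (0 : ℝ) < a := by linarith
  have hI : (1 : ℝ) ≤ ((i : ℝ) + 1) ^ 2 := by
    nlinarith [(Nat.cast_nonneg i : (0 : ℝ) ≤ i)]
  have hnum : ∏ l ∈ range d, |(k : ℝ) - (a * (l + 1) ^ 2 : ℕ)| ≤
      (a * ((i : ℝ) + 1) ^ 2) * ∏ l ∈ (range d).erase i, (a * ((l : ℝ) + 1) ^ 2) := by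
    rw [mul_prod_erase (range d) (fun l : ℕ => (a * ((l : ℝ) + 1) ^ 2)) (mem_range.2 hi)]
    refine prod_le_prod (fun _ _ => abs_nonneg _) fun l _ => ?_
    have : (k : ℝ) < (a * (l + 1) ^ 2 : ℕ) := by exact_mod_cast lt_square_node hka l
    rw [abs_of_nonpos (by linarith)]
    push_cast
    linarith
  have hden : (a * ((i : ℝ) + 1) ^ 2 / 2) ^ (k + 1) ≤
      ∏ r ∈ range (k + 1), |((a * (i + 1) ^ 2 : ℕ) : ℝ) - r| := by
    rw [← card_range (k + 1), ← prod_const, card_range]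
    refine prod_le_prod (fun _ _ => by positivity) fun r hr => ?_
    have hr : (r : ℝ) ≤ k := by exact_mod_cast Nat.lt_succ_iff.1 (mem_range.1 hr)
    have : (a : ℝ) ≤ a * ((i : ℝ) + 1) ^ 2 := le_mul_of_one_le_right ha0.le hI
    push_cast
    rw [abs_of_nonneg (by linarith)]
    linarith
  have hden0 : 0 < (a * ((i : ℝ) + 1) ^ 2 / 2) ^ (k + 1) := by positivity
  have hratio : (∏ l ∈ (range d).erase i, (a * ((l : ℝ) + 1) ^ 2)) /
      ∏ l ∈ (range d).erase i, |((a * (i + 1) ^ 2 : ℕ) : ℝ) - (a * (l + 1) ^ 2 : ℕ)| ≤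
        2 * Real.exp (-(((i : ℝ) + 1) ^ 2 / (2 * d))) := by
    have h1 := prod_sq_ratio hi
    have h2 := factorial_sq_div_le hi
    rw [← prod_div_distrib]
    calc _ = ∏ l ∈ (range d).erase i,
          (((l : ℝ) + 1) ^ 2 / |((i : ℝ) + 1) ^ 2 - ((l : ℝ) + 1) ^ 2|) := by
          refine prod_congr rfl fun l _ => ?_
          push_cast
          rw [← mul_sub, abs_mul, abs_of_pos ha0, mul_div_mul_left _ _ ha0.ne']
      _ ≤ _ := by
          rw [h1, mul_div_assoc]
          push_cast at h2 ⊢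
          linarith
  rw [blockDual, abs_div, abs_prod, abs_prod, prod_blockNodes_erase_small hka le_rfl,
    prod_erase_abs_sub le_rfl, prod_blockNodes_erase_square hka]
  simp only [Nat.sub_self, Nat.factorial_zero, Nat.cast_one, mul_one]
  set A := ∏ l ∈ range d, |(k : ℝ) - (a * (l + 1) ^ 2 : ℕ)|
  set B := ∏ l ∈ (range d).erase i, (a * ((l : ℝ) + 1) ^ 2)
  set C := ∏ r ∈ range (k + 1), |((a * (i + 1) ^ 2 : ℕ) : ℝ) - r|
  set E := ∏ l ∈ (range d).erase i, |((a * (i + 1) ^ 2 : ℕ) : ℝ) - (a * (l + 1) ^ 2 : ℕ)|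
  have hB : 0 ≤ B := prod_nonneg fun _ _ => by positivity
  have hE : 0 ≤ E := prod_nonneg fun _ _ => abs_nonneg _
  calc k.factorial * A / (C * E)
      = k.factorial * A / C / E := by rw [div_div]
    _ ≤ k.factorial * ((a * ((i : ℝ) + 1) ^ 2) * B) / (a * ((i : ℝ) + 1) ^ 2 / 2) ^ (k + 1) / E := by
        gcongr
    _ = k.factorial * ((a * ((i : ℝ) + 1) ^ 2)) / (a * ((i : ℝ) + 1) ^ 2 / 2) ^ (k + 1) * (B / E) := by
        ring
    _ ≤ k.factorial * ((a * ((i : ℝ) + 1) ^ 2)) / (a * ((i : ℝ) + 1) ^ 2 / 2) ^ (k + 1) *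
          (2 * Real.exp (-(((i : ℝ) + 1) ^ 2 / (2 * d)))) := by
        gcongr
    _ = (k.factorial * 2 ^ (k + 2) / (a : ℝ) ^ k) *
        (Real.exp (-(((i : ℝ) + 1) ^ 2 / (2 * d))) / (((i : ℝ) + 1) ^ 2) ^ k) := by
        rw [div_pow, mul_pow]
        have : ((i : ℝ) + 1) ^ 2 ≠ 0 := by positivity
        field_simp
        ring
    _ ≤ _ := by
        gcongr
        exact le_self_pow₀ hI (by omega)

lemma sum_range_inv_succ_sq_le (d : ℕ) : ∑ i ∈ range d, 1 / ((i : ℝ) + 1) ^ 2 ≤ 2 := by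
  have h := sum_Ioo_inv_sq_le (α := ℝ) 0 (d + 1)
  have e : Ioo 0 (d + 1) = (range d).image (· + 1) := by
    ext t
    simp only [mem_Ioo, mem_image, mem_range]
    exact ⟨fun h => ⟨t - 1, by omega, by omega⟩, fun ⟨i, hi, h⟩ => by omega⟩
  rw [e, sum_image (fun _ _ _ _ h => by simpa using h)] at h
  simpa using h

/-- Two weight distributions that agree on polynomials of degree at most `d`, such that reaching
weight `k` is very unlikely under `μ` but has constant probability under `ν`. -/
lemma exists_block_laws {k a d N : ℕ} {δ : ℝ} (hk : 3 ≤ k) (ha : 2 * k ≤ a) (hd : 1 ≤ d)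
    (hN : a * d ^ 2 ≤ N) (hδ : k.factorial * 2 ^ (k + 2) / (a : ℝ) ^ k ≤ δ) (hδ1 : δ ≤ 1) :
    ∃ μ ν : ℕ → ℝ, (∀ t, 0 ≤ μ t) ∧ (∀ t, 0 ≤ ν t) ∧
      ∑ t ∈ range (N + 1), μ t = 1 ∧ ∑ t ∈ range (N + 1), ν t = 1 ∧
      (∀ q : Polynomial ℝ, q.natDegree ≤ d →
        ∑ t ∈ range (N + 1), μ t * q.eval (t : ℝ) = ∑ t ∈ range (N + 1), ν t * q.eval (t : ℝ)) ∧
      ∑ t ∈ range (N + 1), μ t * (if k ≤ t then 1 else 0) ≤ 2 * δ ∧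
      1 / 2 ^ k ≤ ∑ t ∈ range (N + 1), ν t * (if k ≤ t then 1 else 0) ∧
      ∑ t ∈ range (N + 1), μ t * Real.exp (t / (2 * a * d)) ≤
        Real.exp (k / (2 * a * d)) + 2 * δ ∧
      ∑ t ∈ range (N + 1), ν t * Real.exp (t / (2 * a * d)) ≤
        Real.exp (k / (2 * a * d)) + 2 * δ := by
  have hka : k < a := by omega
  set S := blockNodes k a d with hS
  set W := blockDual k a d with hW
  have hδ0 : 0 ≤ δ := le_trans (by positivity) hδ
  have hkS : k ∈ S := mem_union_left _ (by simp)
  have haN : a ≤ N := le_trans (Nat.le_mul_of_pos_right a (by positivity)) hN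
  have hSN : S ⊆ range (N + 1) := by
    intro t ht
    rw [mem_range, Nat.lt_succ_iff]
    rcases mem_union.1 ht with h | h
    · have := mem_range.1 h
      omega
    · obtain ⟨i, hi, rfl⟩ := mem_image.1 h
      have := mem_range.1 hi
      exact le_trans (Nat.mul_le_mul_left a (Nat.pow_le_pow_left (by omega) 2)) hN
  have hsq : ∀ i ∈ range d, |W (a * (i + 1) ^ 2)| * Real.exp (((i : ℝ) + 1) ^ 2 / (2 * d)) ≤
      δ * (1 / ((i : ℝ) + 1) ^ 2) := by
    intro i hi
    have h := abs_blockDual_square_le hk ha (mem_range.1 hi)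
    calc _ ≤ δ * (Real.exp (-(((i : ℝ) + 1) ^ 2 / (2 * d))) / ((i : ℝ) + 1) ^ 2) *
          Real.exp (((i : ℝ) + 1) ^ 2 / (2 * d)) := by
          gcongr
          exact h.trans (by gcongr)
      _ = _ := by
          rw [Real.exp_neg]
          field_simp
  have hsq' : ∑ i ∈ range d, |W (a * (i + 1) ^ 2)| * Real.exp (((i : ℝ) + 1) ^ 2 / (2 * d)) ≤
      2 * δ := by
    refine (sum_le_sum hsq).trans ?_
    rw [← mul_sum]
    nlinarith [sum_range_inv_succ_sq_le d]
  have hlarge : ∑ i ∈ range d, |W (a * (i + 1) ^ 2)| ≤ 2 * δ := by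
    refine (sum_le_sum fun i _ => ?_).trans hsq'
    exact le_mul_of_one_le_right (abs_nonneg _) (Real.one_le_exp (by positivity))
  have habs : ∑ t ∈ S, |W t| ≤ 2 ^ (k + 1) := by
    rw [hS, sum_blockNodes hka]
    have h1 : ∑ t ∈ range (k + 1), |W t| ≤ 2 ^ k := by
      refine (sum_le_sum fun t ht =>
        abs_blockDual_small_le hka (Nat.lt_succ_iff.1 (mem_range.1 ht)) d).trans ?_
      exact_mod_cast (Nat.sum_range_choose k).le
    have h2 : (2 : ℝ) ≤ 2 ^ k := by
      calc (2 : ℝ) = 2 ^ 1 := by norm_num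
        _ ≤ 2 ^ k := pow_le_pow_right₀ (by norm_num) (by omega)
    rw [pow_succ]
    linarith
  have hzero : ∑ t ∈ S, W t = 0 := by
    simpa using sum_blockDual_mul_eval (show 1 ≤ k by omega) hka (1 : Polynomial ℝ) (d := d) (by simp)
  set Z := ∑ t ∈ S, max (W t) 0 with hZ
  have hmax : ∀ t, max (W t) 0 - max (-W t) 0 = W t := fun t => by
    rcases le_total (W t) 0 with h | h
    · rw [max_eq_right h, max_eq_left (by linarith)]; ring
    · rw [max_eq_left h, max_eq_right (by linarith)]; ring
  have hmax' : ∀ t, max (W t) 0 + max (-W t) 0 = |W t| := fun t => by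
    rcases le_total (W t) 0 with h | h
    · rw [max_eq_right h, max_eq_left (by linarith), abs_of_nonpos h]; ring
    · rw [max_eq_left h, max_eq_right (by linarith), abs_of_nonneg h]; ring
  have hZ' : ∑ t ∈ S, max (-W t) 0 = Z := by
    have : ∑ t ∈ S, (max (W t) 0 - max (-W t) 0) = 0 := by simp only [hmax, hzero]
    rw [sum_sub_distrib] at this
    linarith
  have hZ1 : 1 ≤ Z := by
    have h := single_le_sum (f := fun t => max (W t) 0) (fun t _ => le_max_right _ _) hkS
    refine le_trans ?_ h
    rw [hW, blockDual_self]
    simp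
  have hZ2 : Z ≤ 2 ^ k := by
    have : ∑ t ∈ S, (max (W t) 0 + max (-W t) 0) ≤ 2 ^ (k + 1) := by simpa only [hmax'] using habs
    rw [sum_add_distrib, hZ', ← hZ, pow_succ] at this
    linarith
  have hZ0 : 0 < Z := by linarith
  have conv : ∀ g F : ℕ → ℝ, ∑ t ∈ range (N + 1), (if t ∈ S then g t / Z else 0) * F t =
      (∑ t ∈ S, g t * F t) / Z := by
    intro g F
    simp only [ite_mul, zero_mul]
    rw [sum_ite_mem, inter_eq_right.2 hSN, sum_div]
    exact sum_congr rfl fun t _ => by ring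
  have total : ∀ g : ℕ → ℝ, ∑ t ∈ S, g t = Z →
      ∑ t ∈ range (N + 1), (if t ∈ S then g t / Z else 0) = 1 := by
    intro g hg
    have := conv g (fun _ => 1)
    simp only [mul_one] at this
    rw [this, hg, div_self hZ0.ne']
  have tail : ∀ g : ℕ → ℝ, (∀ t, 0 ≤ g t) → (∀ t, g t ≤ |W t|) → ∑ t ∈ S, g t = Z →
      ∑ t ∈ range (N + 1), (if t ∈ S then g t / Z else 0) * Real.exp (t / (2 * a * d)) ≤
        Real.exp (k / (2 * a * d)) + 2 * δ := by
    intro g hg0 hg hgZ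
    rw [conv g (fun t => Real.exp (t / (2 * a * d))), div_le_iff₀ hZ0, hS, sum_blockNodes hka]
    have h1 : ∑ t ∈ range (k + 1), g t * Real.exp (t / (2 * a * d)) ≤
        Real.exp (k / (2 * a * d)) * Z := by
      rw [← hgZ, mul_comm (Real.exp _), sum_mul]
      refine (sum_le_sum (g := fun t => g t * Real.exp (k / (2 * a * d))) fun t ht => ?_).trans
        (sum_le_sum_of_subset_of_nonneg subset_union_left fun t _ _ =>
          mul_nonneg (hg0 t) (Real.exp_pos _).le)
      have : (t : ℝ) ≤ k := by exact_mod_cast Nat.lt_succ_iff.1 (mem_range.1 ht)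
      have := hg0 t
      gcongr
    have h2 : ∑ i ∈ range d, g (a * (i + 1) ^ 2) *
        Real.exp ((a * (i + 1) ^ 2 : ℕ) / (2 * a * d)) ≤ 2 * δ := by
      refine le_trans (sum_le_sum fun i _ => ?_) hsq'
      have e : ((a * (i + 1) ^ 2 : ℕ) : ℝ) / (2 * a * d) = ((i : ℝ) + 1) ^ 2 / (2 * d) := by
        have : (a : ℝ) ≠ 0 := by
          have : 0 < a := by omega
          positivity
        push_cast
        field_simp
      rw [e]
      exact mul_le_mul_of_nonneg_right (hg _) (Real.exp_pos _).le
    nlinarith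
  refine ⟨fun t => if t ∈ S then max (-W t) 0 / Z else 0,
    fun t => if t ∈ S then max (W t) 0 / Z else 0, fun t => ?_, fun t => ?_,
    total _ hZ', total _ rfl, fun q hq => ?_, ?_, ?_, ?_, ?_⟩
  · dsimp only
    split_ifs
    · positivity
    · exact le_rfl
  · dsimp only
    split_ifs
    · positivity
    · exact le_rfl
  · rw [conv (fun t => max (-W t) 0) (fun t => q.eval (t : ℝ)),
      conv (fun t => max (W t) 0) (fun t => q.eval (t : ℝ))]
    congr 1
    have := sum_blockDual_mul_eval (show 1 ≤ k by omega) hka q hq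
    rw [← hS, ← hW, sum_congr rfl (fun t _ => by rw [← hmax t, sub_mul]), sum_sub_distrib] at this
    linarith
  · rw [conv (fun t => max (-W t) 0) (fun t => if k ≤ t then 1 else 0), div_le_iff₀ hZ0, hS,
      sum_blockNodes hka, sum_eq_zero, zero_add]
    · refine (sum_le_sum fun i _ => ?_).trans (hlarge.trans (by nlinarith))
      rw [if_pos (lt_square_node hka i).le, mul_one]
      exact max_le (neg_le_abs _) (abs_nonneg _)
    · intro t ht
      have ht := mem_range.1 ht
      split_ifs with h
      · rw [show t = k by omega, hW, blockDual_self]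
        simp
      · simp
  · rw [conv (fun t => max (W t) 0) (fun t => if k ≤ t then 1 else 0)]
    have h : 1 ≤ ∑ t ∈ S, max (W t) 0 * (if k ≤ t then 1 else 0) := by
      refine le_trans ?_ (single_le_sum (f := fun t => max (W t) 0 * (if k ≤ t then 1 else 0))
        (fun t _ => ?_) hkS)
      · simp [hW, blockDual_self]
      · split_ifs <;> simp
    gcongr
  · exact tail _ (fun t => le_max_right _ _) (fun t => max_le (neg_le_abs _) (abs_nonneg _)) hZ'
  · exact tail _ (fun t => le_max_right _ _) (fun t => max_le (le_abs_self _) (abs_nonneg _)) rfl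

/-- The set of `true` coordinates of an input. -/
def trueSet {N R : ℕ} (x : Fin R → Fin N → Bool) : Finset (Fin R × Fin N) :=
  Finset.univ.filter (fun p => x p.1 p.2 = true)

/-- The input whose set of `true` coordinates is `Y`. -/
noncomputable def ofTrueSet {N R : ℕ} (Y : Finset (Fin R × Fin N)) : Fin R → Fin N → Bool :=
  fun i j => decide ((i, j) ∈ Y)

lemma trueSet_ofTrueSet {N R : ℕ} (Y : Finset (Fin R × Fin N)) : trueSet (ofTrueSet Y) = Y := by
  ext p
  simp [trueSet, ofTrueSet]

lemma card_trueSet {N R : ℕ} (x : Fin R → Fin N → Bool) : (trueSet x).card = wt2 x := rfl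

/-- `ζ` is orthogonal to all conjunctions of at most `D` variables. -/
def Annihilates {N R : ℕ} (ζ : (Fin R → Fin N → Bool) → ℝ) (D : ℕ) : Prop :=
  ∀ U : Finset (Fin R × Fin N), U.card ≤ D → ∑ x, ζ x * (if U ⊆ trueSet x then 1 else 0) = 0

lemma prod_ite_one_zero {α : Type*} (S : Finset α) (p : α → Prop) [DecidablePred p] (q : Prop)
    [Decidable q] (h : (∀ e ∈ S, p e) ↔ q) :
    ∏ e ∈ S, (if p e then (1 : ℝ) else 0) = if q then 1 else 0 := by
  split_ifs with hq
  · exact prod_eq_one fun e he => if_pos (h.2 hq e he)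
  · have : ∃ e ∈ S, ¬ p e := by
      by_contra hne
      exact hq (h.1 (by simpa using hne))
    obtain ⟨e, he, hpe⟩ := this
    exact prod_eq_zero he (if_neg hpe)

lemma toSign_pow (b : Bool) (m : ℕ) :
    toSign b ^ m = 1 + (if Odd m then -2 else 0) * (if b = true then 1 else 0) := by
  rcases Nat.even_or_odd m with h | h
  · have h' : ¬ Odd m := Nat.not_odd_iff_even.2 h
    cases b <;> simp [toSign, h', h.neg_one_pow]
  · cases b <;> simp [toSign, h, h.neg_one_pow]
    norm_num

lemma Annihilates.sum_eval_mul_eq_zero {N R D : ℕ} {ζ : (Fin R → Fin N → Bool) → ℝ}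
    (h : Annihilates ζ D) (p : MvPolynomial (Fin R × Fin N) ℝ) (hp : p.totalDegree ≤ D) :
    ∑ x, MvPolynomial.eval (fun ij => toSign (x ij.1 ij.2)) p * ζ x = 0 := by
  simp only [MvPolynomial.eval_eq, sum_mul]
  rw [sum_comm]
  refine sum_eq_zero fun m hm => ?_
  have hprod : ∀ x : Fin R → Fin N → Bool, ∏ e ∈ m.support, toSign (x e.1 e.2) ^ m e =
      ∑ U ∈ m.support.powerset, (∏ e ∈ U, (if Odd (m e) then (-2 : ℝ) else 0)) *
        (if U ⊆ trueSet x then 1 else 0) := by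
    intro x
    simp only [toSign_pow]
    rw [prod_one_add]
    refine sum_congr rfl fun U _ => ?_
    rw [prod_mul_distrib]
    congr 1
    exact prod_ite_one_zero U _ _ (by simp [trueSet, subset_iff])
  have hcard : m.support.card ≤ D := by
    refine le_trans ?_ ((MvPolynomial.le_totalDegree hm).trans hp)
    rw [Finsupp.sum, card_eq_sum_ones]
    exact sum_le_sum fun e he => Nat.one_le_iff_ne_zero.2 (Finsupp.mem_support_iff.1 he)
  simp only [hprod, mul_sum, sum_mul]
  rw [sum_comm]
  refine sum_eq_zero fun U hU => ?_
  have hU' := h U ((card_le_card (mem_powerset.1 hU)).trans hcard)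
  calc _ = (p.coeff m * ∏ e ∈ U, (if Odd (m e) then (-2 : ℝ) else 0)) *
        ∑ x, ζ x * (if U ⊆ trueSet x then 1 else 0) := by
        rw [mul_sum]
        exact sum_congr rfl fun x _ => by ring
    _ = 0 := by rw [hU', mul_zero]

/-- The coefficients expressing evaluation of a polynomial of degree at most `D` at `x` through its
values at inputs of Hamming weight at most `D`. -/
noncomputable def lowWeightCoeff {N R : ℕ} (D : ℕ) (x y : Fin R → Fin N → Bool) : ℝ :=
  ∑ S ∈ (trueSet x).powerset.filter (fun S => S.card ≤ D),
    ∑ Y ∈ S.powerset, (-1) ^ (S \ Y).card * (if y = ofTrueSet Y then 1 else 0)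

lemma lowWeightCoeff_eq_zero {N R D : ℕ} {x y : Fin R → Fin N → Bool} (h : D < wt2 y) :
    lowWeightCoeff D x y = 0 := by
  refine sum_eq_zero fun S hS => sum_eq_zero fun Y hY => ?_
  rw [if_neg, mul_zero]
  rintro rfl
  rw [← card_trueSet, trueSet_ofTrueSet] at h
  have := card_le_card (mem_powerset.1 hY)
  have := (mem_filter.1 hS).2
  omega

lemma card_powerset_filter_card_le {α : Type*} (X : Finset α) (D : ℕ) :
    (X.powerset.filter (fun S => S.card ≤ D)).card ≤ (X.card + 1) ^ D := by
  have hsub : X.powerset.filter (fun S => S.card ≤ D) ⊆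
      (range (D + 1)).biUnion (fun j => X.powersetCard j) := by
    intro S hS
    rw [mem_filter, mem_powerset] at hS
    rw [mem_biUnion]
    exact ⟨S.card, mem_range.2 (by omega), mem_powersetCard.2 ⟨hS.1, rfl⟩⟩
  refine (card_le_card hsub).trans (card_biUnion_le.trans ?_)
  rw [add_pow]
  refine sum_le_sum fun j hj => ?_
  have hj := Nat.lt_succ_iff.1 (mem_range.1 hj)
  rw [card_powersetCard, one_pow, mul_one]
  exact (Nat.choose_le_pow _ _).trans
    (Nat.le_mul_of_pos_right _ (Nat.choose_pos hj))

lemma sum_abs_lowWeightCoeff_le {N R : ℕ} (D : ℕ) (x : Fin R → Fin N → Bool) :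
    ∑ y, |lowWeightCoeff D x y| ≤ (2 * ((N : ℝ) * R + 1)) ^ D := by
  have hw : (trueSet x).card ≤ N * R := by
    refine (card_le_univ _).trans ?_
    simp [mul_comm]
  calc ∑ y, |lowWeightCoeff D x y|
      ≤ ∑ y, ∑ S ∈ (trueSet x).powerset.filter (fun S => S.card ≤ D),
          ∑ Y ∈ S.powerset, (if y = ofTrueSet Y then (1 : ℝ) else 0) := by
        refine sum_le_sum fun y _ => (abs_sum_le_sum_abs _ _).trans (sum_le_sum fun S _ =>
          (abs_sum_le_sum_abs _ _).trans (sum_le_sum fun Y _ => ?_))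
        split_ifs <;> simp
    _ = ∑ S ∈ (trueSet x).powerset.filter (fun S => S.card ≤ D), (2 : ℝ) ^ S.card := by
        rw [sum_comm]
        refine sum_congr rfl fun S _ => ?_
        rw [sum_comm]
        simp
    _ ≤ ∑ S ∈ (trueSet x).powerset.filter (fun S => S.card ≤ D), (2 : ℝ) ^ D :=
        sum_le_sum fun S hS => pow_le_pow_right₀ (by norm_num) (mem_filter.1 hS).2
    _ = ((trueSet x).powerset.filter (fun S => S.card ≤ D)).card * (2 : ℝ) ^ D := by simp
    _ ≤ ((N : ℝ) * R + 1) ^ D * 2 ^ D := by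
        gcongr
        have h := (card_powerset_filter_card_le (trueSet x) D).trans
          (Nat.pow_le_pow_left (Nat.succ_le_succ hw) D)
        exact_mod_cast h
    _ = _ := by rw [mul_pow, mul_comm]

lemma sum_neg_one_pow_mul_ite_subset {α : Type*} [DecidableEq α] (S U : Finset α) :
    ∑ Y ∈ S.powerset, (-1 : ℝ) ^ (S \ Y).card * (if U ⊆ Y then 1 else 0) =
      if S = U then 1 else 0 := by
  by_cases hUS : U ⊆ S
  · have h := prod_add (fun _ => (1 : ℝ)) (fun e => -(if e ∈ U then (0 : ℝ) else 1)) S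
    have e1 : ∏ e ∈ S, ((1 : ℝ) + -(if e ∈ U then (0 : ℝ) else 1)) = if S = U then 1 else 0 := by
      have : ∀ e, (1 : ℝ) + -(if e ∈ U then (0 : ℝ) else 1) = if e ∈ U then 1 else 0 := fun e => by
        split_ifs <;> norm_num
      simp only [this]
      exact prod_ite_one_zero S _ _ ⟨fun h => Subset.antisymm h hUS, fun h e he => h ▸ he⟩
    rw [← e1, h]
    refine sum_congr rfl fun Y hY => ?_
    rw [prod_const_one, one_mul, prod_neg]
    congr 1
    have : ∀ e, (if e ∈ U then (0 : ℝ) else 1) = if e ∉ U then 1 else 0 := fun e => by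
      split_ifs <;> simp_all
    simp only [this]
    refine (prod_ite_one_zero _ _ _ ⟨fun h e he => ?_, fun h e he heU => ?_⟩).symm
    · by_contra hne
      exact h e (mem_sdiff.2 ⟨hUS he, hne⟩) he
    · exact (mem_sdiff.1 he).2 (h heU)
  · rw [if_neg (fun h => hUS (Eq.ge h)), sum_eq_zero]
    intro Y hY
    rw [if_neg (fun h => hUS (h.trans (mem_powerset.1 hY))), mul_zero]

lemma sum_lowWeightCoeff_mul {N R D : ℕ} (x : Fin R → Fin N → Bool) {U : Finset (Fin R × Fin N)}
    (hU : U.card ≤ D) :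
    ∑ y, lowWeightCoeff D x y * (if U ⊆ trueSet y then 1 else 0) =
      if U ⊆ trueSet x then 1 else 0 := by
  calc _ = ∑ S ∈ (trueSet x).powerset.filter (fun S => S.card ≤ D),
      ∑ Y ∈ S.powerset, (-1 : ℝ) ^ (S \ Y).card * (if U ⊆ Y then 1 else 0) := by
        simp only [lowWeightCoeff, sum_mul]
        rw [sum_comm]
        refine sum_congr rfl fun S _ => ?_
        rw [sum_comm]
        refine sum_congr rfl fun Y _ => ?_
        rw [sum_eq_single (ofTrueSet Y)]
        · rw [trueSet_ofTrueSet, if_pos rfl, mul_one]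
        · intro y _ hy
          rw [if_neg hy]; ring
        · simp
    _ = _ := by
        simp only [sum_neg_one_pow_mul_ite_subset]
        rw [sum_ite_eq']
        refine if_congr ?_ rfl rfl
        simp [hU]

/-- Mass on inputs of Hamming weight above `N` can be moved to inputs of low weight, at a cost
exponential in the degree that has to be preserved. -/
lemma Annihilates.exists_truncation {N R D : ℕ} {ζ : (Fin R → Fin N → Bool) → ℝ}
    (h : Annihilates ζ D) (hD : D ≤ N) :
    ∃ e : (Fin R → Fin N → Bool) → ℝ, (∀ x, N < wt2 x → e x = 0) ∧
      ∑ x, |e x| ≤ (∑ x ∈ Finset.univ.filter (fun x => N < wt2 x), |ζ x|) *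
        (2 * ((N : ℝ) * R + 1)) ^ D ∧
      Annihilates (fun x => (if N < wt2 x then 0 else ζ x) + e x) D := by
  refine ⟨fun y => ∑ x ∈ Finset.univ.filter (fun x => N < wt2 x), ζ x * lowWeightCoeff D x y,
    fun y hy => sum_eq_zero fun x _ => ?_, ?_, fun U hU => ?_⟩
  · rw [lowWeightCoeff_eq_zero (by omega), mul_zero]
  · calc _ ≤ ∑ y, ∑ x ∈ Finset.univ.filter (fun x => N < wt2 x), |ζ x| * |lowWeightCoeff D x y| := by
          refine sum_le_sum fun y _ => (abs_sum_le_sum_abs _ _).trans ?_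
          exact sum_le_sum fun x _ => (abs_mul _ _).le
      _ = ∑ x ∈ Finset.univ.filter (fun x => N < wt2 x), |ζ x| * ∑ y, |lowWeightCoeff D x y| := by
          rw [sum_comm]
          simp only [mul_sum]
      _ ≤ _ := by
          rw [sum_mul]
          exact sum_le_sum fun x _ =>
            mul_le_mul_of_nonneg_left (sum_abs_lowWeightCoeff_le D x) (abs_nonneg _)
  · have h1 : ∑ y, (∑ x ∈ Finset.univ.filter (fun x => N < wt2 x), ζ x * lowWeightCoeff D x y) *
        (if U ⊆ trueSet y then 1 else 0) = ∑ x, (if N < wt2 x then ζ x else 0) *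
          (if U ⊆ trueSet x then 1 else 0) := by
      simp only [sum_mul]
      rw [sum_comm, sum_filter]
      refine sum_congr rfl fun x _ => ?_
      rw [ite_mul, zero_mul]
      refine if_congr Iff.rfl ?_ rfl
      rw [← sum_lowWeightCoeff_mul x hU, mul_sum]
      exact sum_congr rfl fun y _ => by ring
    simp only [add_mul, sum_add_distrib]
    refine Eq.trans ?_ (h U hU)
    rw [h1, ← sum_add_distrib]
    refine sum_congr rfl fun x _ => ?_
    split_ifs <;> ring

/-- The law of a block of length `N` that is symmetric and whose Hamming weight has law `π`. -/
noncomputable def blockLaw (N : ℕ) (π : ℕ → ℝ) (y : Fin N → Bool) : ℝ :=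
  π (wt y) / N.choose (wt y)

lemma blockLaw_nonneg {N : ℕ} {π : ℕ → ℝ} (hπ : ∀ t, 0 ≤ π t) (y : Fin N → Bool) :
    0 ≤ blockLaw N π y := div_nonneg (hπ _) (Nat.cast_nonneg _)

lemma card_powersetCard_filter_superset {α : Type*} [Fintype α] [DecidableEq α] (T : Finset α)
    {t : ℕ} (h : T.card ≤ t) :
    (((Finset.univ : Finset α).powersetCard t).filter (fun A => T ⊆ A)).card =
      (Fintype.card α - T.card).choose (t - T.card) := by
  rw [← card_compl, ← card_powersetCard]
  refine card_nbij' (fun A => A \ T) (fun B => B ∪ T) ?_ ?_ ?_ ?_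
  · intro A hA
    simp only [mem_coe, mem_filter, mem_powersetCard] at hA ⊢
    refine ⟨fun e he => ?_, ?_⟩
    · have := (mem_sdiff.1 he).2
      simpa using this
    · rw [card_sdiff_of_subset hA.2, hA.1.2]
  · intro B hB
    simp only [mem_coe, mem_filter, mem_powersetCard] at hB ⊢
    refine ⟨⟨subset_univ _, ?_⟩, subset_union_right⟩
    rw [card_union_of_disjoint, hB.2]
    · omega
    · exact disjoint_left.2 fun e he => mem_compl.1 (hB.1 he)
  · intro A hA
    simp only [mem_coe, mem_filter, mem_powersetCard] at hA
    exact sdiff_union_of_subset hA.2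
  · intro B hB
    simp only [mem_coe, mem_powersetCard] at hB
    exact union_sdiff_cancel_right (disjoint_left.2 fun e he => mem_compl.1 (hB.1 he))

/-- The set of `true` coordinates of a block. -/
def blockTrueSet {N : ℕ} (y : Fin N → Bool) : Finset (Fin N) :=
  Finset.univ.filter (fun i => y i = true)

lemma sum_block_eq_sum_finset {N : ℕ} (F : Finset (Fin N) → ℝ) :
    ∑ y : Fin N → Bool, F (blockTrueSet y) = ∑ A : Finset (Fin N), F A := by
  refine sum_nbij' (fun y => blockTrueSet y) (fun A j => decide (j ∈ A)) ?_ ?_ ?_ ?_ ?_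
  · intro _ _; exact mem_univ _
  · intro _ _; exact mem_univ _
  · intro y _
    ext j
    simp [blockTrueSet]
  · intro A _
    ext j
    simp [blockTrueSet]
  · intro _ _; rfl

lemma sum_blockLaw_mul_subset {N : ℕ} (π F : ℕ → ℝ) (T : Finset (Fin N)) :
    ∑ y : Fin N → Bool, blockLaw N π y * (F (wt y) * (if T ⊆ blockTrueSet y then 1 else 0)) =
      ∑ t ∈ range (N + 1), π t * (F t * ((t.choose T.card : ℝ) / N.choose T.card)) := by
  have h1 := sum_block_eq_sum_finset
    (fun A : Finset (Fin N) => π A.card / N.choose A.card * (F A.card * (if T ⊆ A then 1 else 0)))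
  refine Eq.trans h1 ?_
  have hT : T.card ≤ N := by simpa using card_le_univ T
  rw [← powerset_univ, sum_powerset, card_univ, Fintype.card_fin]
  refine sum_congr rfl fun t ht => ?_
  have ht : t ≤ N := Nat.lt_succ_iff.1 (mem_range.1 ht)
  have hcount : (∑ A ∈ powersetCard t (Finset.univ : Finset (Fin N)), if T ⊆ A then (1 : ℝ) else 0) =
      N.choose t * ((t.choose T.card : ℝ) / N.choose T.card) := by
    rw [sum_boole]
    rcases le_or_gt T.card t with h | h
    · rw [card_powersetCard_filter_superset T h, Fintype.card_fin]
      have e := Nat.choose_mul (n := N) h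
      have h0 : (N.choose T.card : ℝ) ≠ 0 := by exact_mod_cast (Nat.choose_pos hT).ne'
      rw [eq_comm, mul_div_assoc', div_eq_iff h0, mul_comm ((_ : ℕ) : ℝ) (N.choose T.card : ℝ)]
      exact_mod_cast e
    · rw [Nat.choose_eq_zero_of_lt h, filter_false_of_mem]
      · simp
      · intro A hA hTA
        have := card_le_card hTA
        rw [(mem_powersetCard.1 hA).2] at this
        omega
  have h0 : (N.choose t : ℝ) ≠ 0 := by exact_mod_cast (Nat.choose_pos ht).ne'
  calc _ = ∑ A ∈ powersetCard t (Finset.univ : Finset (Fin N)),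
        (π t / N.choose t * F t) * (if T ⊆ A then (1 : ℝ) else 0) := by
        refine sum_congr rfl fun A hA => ?_
        rw [(mem_powersetCard.1 hA).2, mul_assoc]
    _ = _ := by
        rw [← mul_sum, hcount]
        field_simp

lemma sum_blockLaw_mul {N : ℕ} (π F : ℕ → ℝ) :
    ∑ y : Fin N → Bool, blockLaw N π y * F (wt y) = ∑ t ∈ range (N + 1), π t * F t := by
  simpa using sum_blockLaw_mul_subset (N := N) π F ∅

lemma sum_blockLaw_eq_one {N : ℕ} {π : ℕ → ℝ} (h : ∑ t ∈ range (N + 1), π t = 1) :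
    ∑ y : Fin N → Bool, blockLaw N π y = 1 := by
  simpa [h] using sum_blockLaw_mul (N := N) π (fun _ => 1)

lemma sum_blockLaw_subset_congr {N d : ℕ} {μ ν : ℕ → ℝ}
    (h : ∀ q : Polynomial ℝ, q.natDegree ≤ d →
      ∑ t ∈ range (N + 1), μ t * q.eval (t : ℝ) = ∑ t ∈ range (N + 1), ν t * q.eval (t : ℝ))
    {T : Finset (Fin N)} (hT : T.card ≤ d) :
    ∑ y : Fin N → Bool, blockLaw N μ y * (if T ⊆ blockTrueSet y then 1 else 0) =
      ∑ y : Fin N → Bool, blockLaw N ν y * (if T ⊆ blockTrueSet y then 1 else 0) := by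
  have key : ∀ π : ℕ → ℝ, ∑ y : Fin N → Bool,
      blockLaw N π y * (if T ⊆ blockTrueSet y then 1 else 0) =
      (∑ t ∈ range (N + 1), π t * (descPochhammer ℝ T.card).eval (t : ℝ)) *
        (1 / (T.card.factorial * N.choose T.card)) := by
    intro π
    have h1 := sum_blockLaw_mul_subset (N := N) π (fun _ => 1) T
    simp only [one_mul] at h1
    rw [h1, sum_mul]
    refine sum_congr rfl fun t _ => ?_
    rw [descPochhammer_eval_eq_descFactorial, Nat.descFactorial_eq_factorial_mul_choose]
    push_cast
    have : (T.card.factorial : ℝ) ≠ 0 := by positivity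
    field_simp
  rw [key, key, h]
  rwa [descPochhammer_natDegree]

lemma sum_prod_eq_prod_sum {N R : ℕ} (g : Fin R → (Fin N → Bool) → ℝ) :
    ∑ x : Fin R → Fin N → Bool, ∏ i, g i (x i) = ∏ i, ∑ y, g i y := by
  rw [prod_univ_sum, Fintype.piFinset_univ]

lemma annihilates_prod_sub_prod {N R d : ℕ} {μ ν : ℕ → ℝ}
    (h : ∀ q : Polynomial ℝ, q.natDegree ≤ d →
      ∑ t ∈ range (N + 1), μ t * q.eval (t : ℝ) = ∑ t ∈ range (N + 1), ν t * q.eval (t : ℝ)) :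
    Annihilates (fun x : Fin R → Fin N → Bool =>
      ∏ i, blockLaw N μ (x i) - ∏ i, blockLaw N ν (x i)) d := by
  intro U hU
  set T : Fin R → Finset (Fin N) := fun i => Finset.univ.filter (fun j => (i, j) ∈ U)
  have hT : ∀ i, (T i).card ≤ d := fun i => by
    refine le_trans ?_ hU
    refine card_le_card_of_injOn (fun j => (i, j)) (fun j hj => ?_) (fun j _ j' _ h => ?_)
    · exact (mem_filter.1 hj).2
    · exact (Prod.mk.inj h).2
  have hsub : ∀ x : Fin R → Fin N → Bool, (if U ⊆ trueSet x then (1 : ℝ) else 0) =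
      ∏ i, (if T i ⊆ blockTrueSet (x i) then 1 else 0) := by
    intro x
    refine (prod_ite_one_zero _ _ _ ⟨fun hx p hp => ?_, fun hx i _ j hj => ?_⟩).symm
    · have := hx p.1 (mem_univ _) (mem_filter.2 ⟨mem_univ p.2, hp⟩)
      simpa [blockTrueSet, trueSet] using this
    · have := hx (mem_filter.1 hj).2
      simpa [blockTrueSet, trueSet] using this
  simp only [hsub, sub_mul, ← prod_mul_distrib, sum_sub_distrib]
  rw [sum_prod_eq_prod_sum (fun i y => blockLaw N μ y * (if T i ⊆ blockTrueSet y then 1 else 0)),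
    sum_prod_eq_prod_sum (fun i y => blockLaw N ν y * (if T i ⊆ blockTrueSet y then 1 else 0)),
    sub_eq_zero]
  exact prod_congr rfl fun i _ => sum_blockLaw_subset_congr h (hT i)

/-- Markov's inequality for a product law and a multiplicative test function. -/
lemma mul_sum_prod_le_pow {N R : ℕ} {π g : (Fin N → Bool) → ℝ} (hπ : ∀ y, 0 ≤ π y)
    (hg : ∀ y, 0 ≤ g y) {M : ℝ} (E : (Fin R → Fin N → Bool) → Prop) [DecidablePred E]
    (hE : ∀ x, E x → M ≤ ∏ i, g (x i)) :
    M * ∑ x ∈ Finset.univ.filter E, ∏ i, π (x i) ≤ (∑ y, π y * g y) ^ R := by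
  have h := sum_prod_eq_prod_sum (R := R) (fun _ y => π y * g y)
  rw [prod_const, card_univ, Fintype.card_fin] at h
  rw [← h, mul_sum]
  refine (sum_le_sum fun x hx => ?_).trans
    (sum_le_sum_of_subset_of_nonneg (filter_subset E _) fun x _ _ =>
      prod_nonneg fun i _ => mul_nonneg (hπ _) (hg _))
  rw [prod_mul_distrib, mul_comm]
  exact mul_le_mul_of_nonneg_left (hE x (mem_filter.1 hx).2) (prod_nonneg fun i _ => hπ _)

lemma wt2_eq_sum_wt {N R : ℕ} (x : Fin R → Fin N → Bool) : wt2 x = ∑ i, wt (x i) := by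
  simp only [wt2, wt, card_filter, Fintype.sum_prod_type]

lemma sum_exists_THR_le {N R k : ℕ} {μ : ℕ → ℝ} {q : ℝ} (hμ : ∀ t, 0 ≤ μ t)
    (h1 : ∑ t ∈ range (N + 1), μ t = 1)
    (hq : ∑ t ∈ range (N + 1), μ t * (if k ≤ t then 1 else 0) ≤ q) (hqR : 1000 * q * R ≤ 1) :
    ∑ x ∈ Finset.univ.filter (fun x : Fin R → Fin N → Bool => ¬ ∀ i, THR N k (x i) = false),
      ∏ i, blockLaw N μ (x i) ≤ 1 / 20 := by
  have hg1 : ∀ y : Fin N → Bool, (1 : ℝ) ≤ 1 + 1000 * (if k ≤ wt y then 1 else 0) := fun y => by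
    split_ifs <;> norm_num
  have hM := mul_sum_prod_le_pow (R := R) (M := 1001) (blockLaw_nonneg (N := N) hμ)
    (fun y => zero_le_one.trans (hg1 y))
    (fun x : Fin R → Fin N → Bool => ¬ ∀ i, THR N k (x i) = false) (fun x hx => by
      simp only [not_forall] at hx
      obtain ⟨i, hi⟩ := hx
      have hi : k ≤ wt (x i) := by simpa [THR] using hi
      rw [← mul_prod_erase Finset.univ _ (mem_univ i), if_pos hi]
      have : (1 : ℝ) ≤ ∏ l ∈ Finset.univ.erase i, (1 + 1000 * (if k ≤ wt (x l) then (1 : ℝ) else 0)) := by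
        calc (1 : ℝ) = ∏ _l ∈ Finset.univ.erase i, (1 : ℝ) := by simp
          _ ≤ _ := prod_le_prod (fun _ _ => zero_le_one) fun l _ => hg1 (x l)
      linarith)
  have hs : ∑ y : Fin N → Bool, blockLaw N μ y * (1 + 1000 * (if k ≤ wt y then 1 else 0)) ≤
      Real.exp (1000 * q) := by
    rw [sum_blockLaw_mul μ (fun t => 1 + 1000 * (if k ≤ t then 1 else 0))]
    have : ∑ t ∈ range (N + 1), μ t * (1 + 1000 * (if k ≤ t then 1 else 0)) =
        ∑ t ∈ range (N + 1), μ t +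
          1000 * ∑ t ∈ range (N + 1), μ t * (if k ≤ t then 1 else 0) := by
      rw [mul_sum, ← sum_add_distrib]
      exact sum_congr rfl fun t _ => by ring
    rw [this, h1]
    linarith [Real.add_one_le_exp (1000 * q)]
  have hpow := pow_le_pow_left₀ (sum_nonneg fun y _ =>
    mul_nonneg (blockLaw_nonneg (N := N) hμ y) (zero_le_one.trans (hg1 y))) hs R
  rw [← Real.exp_nat_mul] at hpow
  have he : Real.exp (R * (1000 * q)) ≤ Real.exp 1 := Real.exp_le_exp.2 (by linarith)
  linarith [Real.exp_one_lt_d9]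

lemma sum_few_THR_le {N R k : ℕ} {ν : ℕ → ℝ} {γ : ℝ} (hν : ∀ t, 0 ≤ ν t)
    (h1 : ∑ t ∈ range (N + 1), ν t = 1)
    (hp : 2 * γ ≤ ∑ t ∈ range (N + 1), ν t * (if k ≤ t then 1 else 0)) (hγR : 64 ≤ γ * R) :
    ∑ x ∈ Finset.univ.filter (fun x : Fin R → Fin N → Bool =>
      ((Finset.univ.filter (fun i => THR N k (x i) = true)).card : ℝ) < γ * R),
      ∏ i, blockLaw N ν (x i) ≤ 1 / 20 := by
  have hg0 : ∀ y : Fin N → Bool, (0 : ℝ) ≤ if k ≤ wt y then 1 / 2 else 1 := fun y => by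
    split_ifs <;> norm_num
  have hM := mul_sum_prod_le_pow (R := R) (M := Real.exp (-(Real.log 2 * (γ * R))))
    (blockLaw_nonneg (N := N) hν) hg0 (fun x : Fin R → Fin N → Bool =>
      ((Finset.univ.filter (fun i => THR N k (x i) = true)).card : ℝ) < γ * R) (fun x hx => by
      have e : ∏ i, (if k ≤ wt (x i) then (1 / 2 : ℝ) else 1) =
          (1 / 2) ^ (Finset.univ.filter (fun i => THR N k (x i) = true)).card := by
        rw [prod_ite, prod_const, prod_const_one, mul_one]
        simp [THR]
      rw [e, one_div, inv_pow, ← Real.exp_log (show (0 : ℝ) < 2 by norm_num), ← Real.exp_nat_mul,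
        ← Real.exp_neg, Real.exp_le_exp, Real.log_exp]
      nlinarith [Real.log_pos one_lt_two])
  have hs : ∑ y : Fin N → Bool, blockLaw N ν y * (if k ≤ wt y then 1 / 2 else 1) ≤
      Real.exp (-γ) := by
    rw [sum_blockLaw_mul ν (fun t => if k ≤ t then 1 / 2 else 1)]
    have : ∑ t ∈ range (N + 1), ν t * (if k ≤ t then 1 / 2 else 1) =
        ∑ t ∈ range (N + 1), ν t -
          1 / 2 * ∑ t ∈ range (N + 1), ν t * (if k ≤ t then 1 else 0) := by
      rw [mul_sum, ← sum_sub_distrib]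
      exact sum_congr rfl fun t _ => by split_ifs <;> ring
    rw [this, h1]
    linarith [Real.add_one_le_exp (-γ)]
  have hpow := pow_le_pow_left₀ (sum_nonneg fun y _ =>
    mul_nonneg (blockLaw_nonneg (N := N) hν y) (hg0 y)) hs R
  rw [← Real.exp_nat_mul] at hpow
  have h2 := hM.trans hpow
  rw [mul_comm, ← le_div_iff₀ (Real.exp_pos _), ← Real.exp_sub] at h2
  refine h2.trans ?_
  have hl := Real.log_two_lt_d9
  calc _ ≤ Real.exp (-19) := Real.exp_le_exp.2 (by nlinarith)
    _ ≤ 1 / 20 := by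
      rw [Real.exp_neg, one_div]
      exact inv_anti₀ (by norm_num) (by linarith [Real.add_one_le_exp (19 : ℝ)])

lemma sum_heavy_le {N R k a d : ℕ} {π : ℕ → ℝ} {δ : ℝ} (hπ : ∀ t, 0 ≤ π t) (ha : 1 ≤ a)
    (hd : 1 ≤ d) (hN : a * d ^ 2 ≤ N) (hkR : 2 * (k * R) ≤ N) (hδ0 : 0 ≤ δ) (hδ : 2 * δ * R ≤ 1)
    (h : ∑ t ∈ range (N + 1), π t * Real.exp (t / (2 * a * d)) ≤
        Real.exp (k / (2 * a * d)) + 2 * δ) :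
    ∑ x ∈ Finset.univ.filter (fun x : Fin R → Fin N → Bool => N < wt2 x),
      ∏ i, blockLaw N π (x i) ≤ Real.exp (1 - d / 4) := by
  have haR : (1 : ℝ) ≤ a := by exact_mod_cast ha
  have hdR : (1 : ℝ) ≤ d := by exact_mod_cast hd
  have hM := mul_sum_prod_le_pow (R := R) (M := Real.exp (N / (2 * a * d)))
    (blockLaw_nonneg (N := N) hπ) (g := fun y => Real.exp (wt y / (2 * a * d)))
    (fun y => (Real.exp_pos _).le) (fun x : Fin R → Fin N → Bool => N < wt2 x) (fun x hx => by
      rw [← Real.exp_sum, ← sum_div, ← Nat.cast_sum, ← wt2_eq_sum_wt]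
      have : (N : ℝ) ≤ wt2 x := by exact_mod_cast hx.le
      gcongr)
  rw [sum_blockLaw_mul π (fun t => Real.exp (t / (2 * a * d)))] at hM
  have hs : ∑ t ∈ range (N + 1), π t * Real.exp (t / (2 * a * d)) ≤
      Real.exp (k / (2 * a * d) + 2 * δ) := by
    refine h.trans ?_
    rw [Real.exp_add]
    have h1 : (1 : ℝ) ≤ Real.exp (k / (2 * a * d)) := Real.one_le_exp (by positivity)
    nlinarith [Real.add_one_le_exp (2 * δ)]
  have hpow := pow_le_pow_left₀ (sum_nonneg fun t _ =>
    mul_nonneg (hπ t) (Real.exp_pos _).le) hs R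
  rw [← Real.exp_nat_mul] at hpow
  have h2 := hM.trans hpow
  rw [mul_comm, ← le_div_iff₀ (Real.exp_pos _), ← Real.exp_sub] at h2
  refine h2.trans (Real.exp_le_exp.2 ?_)
  have hkR' : 2 * ((k : ℝ) * R) ≤ N := by exact_mod_cast hkR
  have hN' : (a : ℝ) * d ^ 2 ≤ N := by exact_mod_cast hN
  have e1 : (R : ℝ) * (k / (2 * a * d)) ≤ N / (4 * a * d) := by
    rw [mul_div_assoc', div_le_div_iff₀ (by positivity) (by positivity)]
    have : 0 ≤ (a : ℝ) * d := by positivity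
    nlinarith
  have e2 : (d : ℝ) / 4 ≤ N / (4 * a * d) := by
    rw [div_le_div_iff₀ (by positivity) (by positivity)]
    nlinarith
  have e3 : (N : ℝ) / (2 * a * d) = 2 * (N / (4 * a * d)) := by
    field_simp
    norm_num
  rw [e3]
  linarith

lemma le_correlation {N R k : ℕ} {γ ε : ℝ} (hγR : 0 < γ * R)
    {P Q e : (Fin R → Fin N → Bool) → ℝ} (hP0 : ∀ x, 0 ≤ P x) (hQ0 : ∀ x, 0 ≤ Q x)
    (hP : ∑ x, P x = 1) (hQ : ∑ x, Q x = 1)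
    (hA : ∑ x ∈ Finset.univ.filter (fun x => ¬ ∀ i, THR N k (x i) = false), P x ≤ ε)
    (hB : ∑ x ∈ Finset.univ.filter (fun x =>
      ((Finset.univ.filter (fun i => THR N k (x i) = true)).card : ℝ) < γ * R), Q x ≤ ε)
    (hPN : ∑ x ∈ Finset.univ.filter (fun x => N < wt2 x), P x ≤ ε)
    (hQN : ∑ x ∈ Finset.univ.filter (fun x => N < wt2 x), Q x ≤ ε)
    (he : ∑ x, |e x| ≤ ε) :
    2 - 7 * ε ≤
      (∑ x ∈ Finset.univ.filter (fun x : Fin R → Fin N → Bool => inDom γ N R k x ∧ wt2 x ≤ N),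
        ((if N < wt2 x then 0 else P x - Q x) + e x) * fval N R k x) -
      ∑ x ∈ Finset.univ.filter (fun x : Fin R → Fin N → Bool => ¬ inDom γ N R k x ∧ wt2 x ≤ N),
        |(if N < wt2 x then 0 else P x - Q x) + e x| := by
  rw [sum_filter] at hA hB hPN hQN
  rw [sum_filter, sum_filter, ← sum_sub_distrib]
  have key : ∑ x, (P x + Q x - 2 * (if ¬ ∀ i, THR N k (x i) = false then P x else 0) -
      2 * (if ((Finset.univ.filter (fun i => THR N k (x i) = true)).card : ℝ) < γ * R
        then Q x else 0) - |e x| - (if N < wt2 x then P x else 0) -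
      (if N < wt2 x then Q x else 0)) ≥ 2 - 7 * ε := by
    simp only [sum_sub_distrib, sum_add_distrib, ← mul_sum]
    linarith
  refine key.le.trans (sum_le_sum fun x _ => ?_)
  have hPx := hP0 x
  have hQx := hQ0 x
  have hex := neg_abs_le (e x)
  have hex' := le_abs_self (e x)
  by_cases hN : N < wt2 x
  · rw [if_neg (show ¬ (inDom γ N R k x ∧ wt2 x ≤ N) by omega),
      if_neg (show ¬ (¬ inDom γ N R k x ∧ wt2 x ≤ N) by omega), if_pos hN, if_pos hN]
    have h0 := abs_nonneg (e x)
    split_ifs <;> linarith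
  have hN' : wt2 x ≤ N := by omega
  simp only [hN, hN', if_false, and_true]
  by_cases h1 : ∀ i, THR N k (x i) = false
  · have hc : (Finset.univ.filter (fun i => THR N k (x i) = true)).card = 0 := by
      simp [h1]
    have hdom : inDom γ N R k x := Or.inl h1
    have hf : fval N R k x = 1 := if_pos h1
    rw [if_neg (not_not.2 h1), hc, if_pos (by simpa using hγR), if_pos hdom,
      if_neg (not_not.2 hdom), hf]
    linarith
  · have hf : fval N R k x = -1 := if_neg h1
    by_cases h2 : ((Finset.univ.filter (fun i => THR N k (x i) = true)).card : ℝ) < γ * R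
    · have hdom : ¬ inDom γ N R k x := by
        rintro (h | h)
        · exact h1 h
        · exact absurd h2 (not_lt.2 h)
      rw [if_pos h1, if_pos h2, if_neg hdom, if_pos hdom]
      have : |P x - Q x + e x| ≤ P x + Q x + |e x| :=
        abs_le.2 ⟨by linarith, by linarith⟩
      linarith
    · have hdom : inDom γ N R k x := Or.inr (not_lt.1 h2)
      rw [if_pos h1, if_neg h2, if_pos hdom, if_neg (not_not.2 hdom), hf]
      linarith

/-- The dual witness for given values of the block parameters `a` and `d`. -/
lemma exists_dual_witness {N R k a d D : ℕ} {γ δ : ℝ} (hk : 3 ≤ k) (hγ : 2 * γ ≤ 1 / 2 ^ k)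
    (hγR : 64 ≤ γ * R) (ha : 2 * k ≤ a) (hN : a * d ^ 2 ≤ N) (hkR : 2 * (k * R) ≤ N)
    (hδ : k.factorial * 2 ^ (k + 2) / (a : ℝ) ^ k ≤ δ) (hδ1 : δ ≤ 1) (hδR : 2000 * δ * R ≤ 1)
    (hd : 400 ≤ d) (hDd : D ≤ d) (hDN : D ≤ N)
    (hD : (2 * ((N : ℝ) * R + 1)) ^ D ≤ Real.exp (d / 8)) :
    ∃ ζ : (Fin R → Fin N → Bool) → ℝ,
        (∀ x : Fin R → Fin N → Bool, N < wt2 x → ζ x = 0) ∧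
        (2 / 3 <
          (∑ x ∈ Finset.univ.filter
              (fun x : Fin R → Fin N → Bool => inDom γ N R k x ∧ wt2 x ≤ N),
            ζ x * fval N R k x)
          - ∑ x ∈ Finset.univ.filter
              (fun x : Fin R → Fin N → Bool => ¬ inDom γ N R k x ∧ wt2 x ≤ N),
            |ζ x|) ∧
        (∑ x : Fin R → Fin N → Bool, |ζ x| = 1) ∧ Annihilates ζ D := by
  have hδ0 : 0 ≤ δ := le_trans (by positivity) hδ
  obtain ⟨μ, ν, hμ0, hν0, hμ1, hν1, hmom, hμk, hνk, hμt, hνt⟩ :=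
    exists_block_laws hk ha (show 1 ≤ d by omega) hN hδ hδ1
  set P : (Fin R → Fin N → Bool) → ℝ := fun x => ∏ i, blockLaw N μ (x i) with hPdef
  set Q : (Fin R → Fin N → Bool) → ℝ := fun x => ∏ i, blockLaw N ν (x i) with hQdef
  have hP0 : ∀ x, 0 ≤ P x := fun x => prod_nonneg fun i _ => blockLaw_nonneg hμ0 _
  have hQ0 : ∀ x, 0 ≤ Q x := fun x => prod_nonneg fun i _ => blockLaw_nonneg hν0 _
  have hP1 : ∑ x, P x = 1 := by
    rw [hPdef, sum_prod_eq_prod_sum (fun _ y => blockLaw N μ y), prod_const,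
      sum_blockLaw_eq_one hμ1, one_pow]
  have hQ1 : ∑ x, Q x = 1 := by
    rw [hQdef, sum_prod_eq_prod_sum (fun _ y => blockLaw N ν y), prod_const,
      sum_blockLaw_eq_one hν1, one_pow]
  have hR0 : (0 : ℝ) ≤ δ * R := by positivity
  have hA := sum_exists_THR_le (R := R) hμ0 hμ1 hμk (by linarith)
  have hB := sum_few_THR_le (R := R) hν0 hν1 (hγ.trans hνk) hγR
  have hPN := sum_heavy_le (R := R) hμ0 (show 1 ≤ a by omega) (show 1 ≤ d by omega) hN hkR hδ0
    (by linarith) hμt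
  have hQN := sum_heavy_le (R := R) hν0 (show 1 ≤ a by omega) (show 1 ≤ d by omega) hN hkR hδ0
    (by linarith) hνt
  have hann : Annihilates (fun x => P x - Q x) D := fun U hU =>
    annihilates_prod_sub_prod hmom U (hU.trans hDd)
  have hdR : (400 : ℝ) ≤ d := by exact_mod_cast hd
  have hsmall : Real.exp (1 - d / 8) ≤ 1 / 40 := by
    calc Real.exp (1 - d / 8) ≤ Real.exp (-49) := Real.exp_le_exp.2 (by linarith)
      _ ≤ 1 / 40 := by
        rw [Real.exp_neg, one_div]
        exact inv_anti₀ (by norm_num) (by linarith [Real.add_one_le_exp (49 : ℝ)])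
  have hsmall' : Real.exp (1 - d / 4) ≤ 1 / 20 := by
    have : Real.exp (1 - d / 4 : ℝ) ≤ Real.exp (1 - d / 8) := Real.exp_le_exp.2 (by linarith)
    linarith
  obtain ⟨e, he0, he, hann'⟩ := hann.exists_truncation hDN
  have he' : ∑ x, |e x| ≤ 1 / 20 := by
    refine he.trans ?_
    have h1 : ∑ x ∈ Finset.univ.filter (fun x => N < wt2 x), |P x - Q x| ≤
        2 * Real.exp (1 - d / 4) := by
      calc _ ≤ ∑ x ∈ Finset.univ.filter (fun x => N < wt2 x), (P x + Q x) :=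
            sum_le_sum fun x _ => abs_le.2 ⟨by linarith [hP0 x, hQ0 x], by linarith [hP0 x, hQ0 x]⟩
        _ ≤ _ := by
            rw [sum_add_distrib]
            linarith
    calc _ ≤ 2 * Real.exp (1 - d / 4) * Real.exp (d / 8) := by gcongr
      _ = 2 * Real.exp (1 - d / 8) := by
          rw [mul_assoc, ← Real.exp_add]
          congr 2
          ring
      _ ≤ 1 / 20 := by linarith
  have hcorr := le_correlation (k := k) (show 0 < γ * R by linarith) hP0 hQ0 hP1 hQ1 hA hB
    (hPN.trans hsmall') (hQN.trans hsmall') he'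
  set ζ : (Fin R → Fin N → Bool) → ℝ := fun x => (if N < wt2 x then 0 else P x - Q x) + e x
    with hζ
  set Z := ∑ x, |ζ x| with hZ
  have hZle : Z ≤ 2 + 1 / 20 := by
    calc Z ≤ ∑ x, (P x + Q x + |e x|) := by
          refine sum_le_sum fun x _ => ?_
          have h1 := hP0 x
          have h2 := hQ0 x
          have h3 := neg_abs_le (e x)
          have h4 := le_abs_self (e x)
          rw [hζ]
          dsimp only
          split_ifs
          · exact abs_le.2 ⟨by linarith, by linarith⟩
          · exact abs_le.2 ⟨by linarith, by linarith⟩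
      _ ≤ _ := by
          rw [sum_add_distrib, sum_add_distrib, hP1, hQ1]
          linarith
  have hcorr : 2 - 7 * (1 / 20) ≤
      (∑ x ∈ Finset.univ.filter (fun x : Fin R → Fin N → Bool => inDom γ N R k x ∧ wt2 x ≤ N),
        ζ x * fval N R k x) -
      ∑ x ∈ Finset.univ.filter (fun x : Fin R → Fin N → Bool => ¬ inDom γ N R k x ∧ wt2 x ≤ N),
        |ζ x| := hcorr
  have hZpos : 0 < Z := by
    have h1 : ∑ x ∈ Finset.univ.filter
        (fun x : Fin R → Fin N → Bool => inDom γ N R k x ∧ wt2 x ≤ N), ζ x * fval N R k x ≤ Z := by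
      refine (sum_le_sum (g := fun x => |ζ x|) fun x _ => ?_).trans
        (sum_le_sum_of_subset_of_nonneg (filter_subset _ _) fun x _ _ => abs_nonneg _)
      have h2 := neg_abs_le (ζ x)
      have h3 := le_abs_self (ζ x)
      unfold fval
      split_ifs <;> linarith
    have h2 : 0 ≤ ∑ x ∈ Finset.univ.filter
        (fun x : Fin R → Fin N → Bool => ¬ inDom γ N R k x ∧ wt2 x ≤ N), |ζ x| :=
      sum_nonneg fun x _ => abs_nonneg _
    linarith
  refine ⟨fun x => ζ x / Z, fun x hx => ?_, ?_, ?_, fun U hU => ?_⟩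
  · simp [hζ, hx, he0 x hx]
  · simp only [abs_div, abs_of_pos hZpos, div_mul_eq_mul_div]
    rw [← sum_div, ← sum_div, ← sub_div, lt_div_iff₀ hZpos]
    linarith
  · simp only [abs_div, abs_of_pos hZpos]
    rw [← sum_div, div_self hZpos.ne']
  · simp only [div_mul_eq_mul_div]
    rw [← sum_div, hann' U hU, zero_div]

lemma eventually_parameters_large (k : ℕ) (hk : 3 ≤ k) {γ B A : ℝ} (hγ : 0 < γ) (hB : 0 < B) :
    ∀ᶠ R : ℕ in Filter.atTop, 3 ≤ R ∧ 64 ≤ γ * R ∧ 1 ≤ B * R ∧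
      2 * (k : ℝ) ≤ (B * R) ^ (1 / (k : ℝ)) ∧
      401 * A ≤ Real.sqrt ((R : ℝ) ^ (1 - 1 / (k : ℝ))) := by
  have hk0 : (3 : ℝ) ≤ k := by exact_mod_cast hk
  have hR : Filter.Tendsto (fun R : ℕ => (R : ℝ)) Filter.atTop Filter.atTop :=
    tendsto_natCast_atTop_atTop
  have hBR := hR.const_mul_atTop hB
  have h1 : 1 / (k : ℝ) < 1 := by
    rw [div_lt_one (by linarith)]
    linarith
  have hroot := (tendsto_rpow_atTop (show 0 < 1 / (k : ℝ) by positivity)).comp hBR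
  have hsqrt := Real.tendsto_sqrt_atTop.comp
    ((tendsto_rpow_atTop (show 0 < 1 - 1 / (k : ℝ) by linarith)).comp hR)
  filter_upwards [Filter.eventually_ge_atTop 3,
    (hR.const_mul_atTop hγ).eventually_ge_atTop 64, hBR.eventually_ge_atTop 1,
    hroot.eventually_ge_atTop (2 * (k : ℝ)), hsqrt.eventually_ge_atTop (401 * A)]
    with R h3 h4 h5 h6 h7
  exact ⟨h3, h4, h5, h6, h7⟩

/-- Block parameters: `a` of order `N ^ (1 / k)` and `d` of order `√(N / a)`. -/
lemma exists_parameters {k R N : ℕ} {B A : ℝ} (hk : 3 ≤ k) (hB : 0 < B) (hA0 : 0 < A)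
    (hA : A ^ 2 = 2 * B ^ (1 / (k : ℝ))) (hBR : 1 ≤ B * R) (hRN : R ≤ N) (hR : 1 ≤ R)
    (hk2 : 2 * (k : ℝ) ≤ (B * R) ^ (1 / (k : ℝ)))
    (hs : 401 * A ≤ Real.sqrt ((R : ℝ) ^ (1 - 1 / (k : ℝ)))) :
    ∃ a d : ℕ, 2 * k ≤ a ∧ B * R ≤ (a : ℝ) ^ k ∧ a * d ^ 2 ≤ N ∧ 400 ≤ d ∧
      Real.sqrt ((N : ℝ) ^ (1 - 1 / (k : ℝ))) ≤ 2 * A * d := by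
  have hk0 : (3 : ℝ) ≤ k := by exact_mod_cast hk
  have hRN' : (R : ℝ) ≤ N := by exact_mod_cast hRN
  have hR' : (1 : ℝ) ≤ R := by exact_mod_cast hR
  have hN0 : (0 : ℝ) < N := by linarith
  set α : ℝ := 1 / (k : ℝ) with hα
  have hα0 : 0 ≤ α := by positivity
  have hα1 : α ≤ 1 := by
    rw [hα, div_le_one (by linarith)]
    linarith
  set a := ⌈(B * R) ^ α⌉₊ with ha
  have hage : (B * R) ^ α ≤ a := Nat.le_ceil _
  have ha0 : (0 : ℝ) < a := by linarith
  have hroot : 1 ≤ (B * R) ^ α := Real.one_le_rpow hBR hα0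
  have hale : (a : ℝ) ≤ A ^ 2 * (N : ℝ) ^ α := by
    have h1 : (a : ℝ) < (B * R) ^ α + 1 := Nat.ceil_lt_add_one (by positivity)
    have h2 : (B * R) ^ α = B ^ α * (R : ℝ) ^ α := Real.mul_rpow hB.le (by positivity)
    have h3 : (R : ℝ) ^ α ≤ (N : ℝ) ^ α := Real.rpow_le_rpow (by positivity) hRN' hα0
    have h4 : B ^ α * (R : ℝ) ^ α ≤ B ^ α * (N : ℝ) ^ α := by gcongr
    rw [hA]
    linarith
  set s := Real.sqrt ((N : ℝ) / a) with hsdef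
  have hys : Real.sqrt ((N : ℝ) ^ (1 - α)) ≤ A * s := by
    have e : A * s = Real.sqrt (A ^ 2 * (N / a)) := by
      rw [Real.sqrt_mul (sq_nonneg A), Real.sqrt_sq hA0.le]
    rw [e]
    refine Real.sqrt_le_sqrt ?_
    rw [Real.rpow_sub hN0, Real.rpow_one, mul_div_assoc', div_le_div_iff₀ (by positivity) ha0]
    nlinarith
  have hs401 : 401 ≤ s := by
    have h1 : Real.sqrt ((R : ℝ) ^ (1 - α)) ≤ Real.sqrt ((N : ℝ) ^ (1 - α)) :=
      Real.sqrt_le_sqrt (Real.rpow_le_rpow (by positivity) hRN' (by linarith))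
    have h2 : A * 401 ≤ A * s := by linarith
    exact le_of_mul_le_mul_left h2 hA0
  have hd1 : s < ⌊s⌋₊ + 1 := Nat.lt_floor_add_one s
  have hd2 : (⌊s⌋₊ : ℝ) ≤ s := Nat.floor_le (by linarith)
  refine ⟨a, ⌊s⌋₊, ?_, ?_, ?_, Nat.le_floor (by norm_num; linarith), ?_⟩
  · exact_mod_cast hk2.trans hage
  · calc B * R = ((B * R) ^ α) ^ k := by
          rw [hα, one_div, Real.rpow_inv_natCast_pow (by positivity) (by omega)]
      _ ≤ (a : ℝ) ^ k := by gcongr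
  · have h1 : (a : ℝ) * (⌊s⌋₊ : ℝ) ^ 2 ≤ N := by
      calc (a : ℝ) * (⌊s⌋₊ : ℝ) ^ 2 ≤ a * s ^ 2 := by gcongr
        _ = (N : ℝ) := by
          rw [hsdef, Real.sq_sqrt (by positivity)]
          field_simp
    exact_mod_cast h1
  · nlinarith

lemma pow_le_exp_of_le_div_log {N R D : ℕ} {x : ℝ} (hN : 3 ≤ N) (hRN : R ≤ N)
    (hD : (D : ℝ) ≤ x / (24 * Real.log N)) :
    (2 * ((N : ℝ) * R + 1)) ^ D ≤ Real.exp (x / 8) := by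
  have hN' : (3 : ℝ) ≤ N := by exact_mod_cast hN
  have hRN' : (R : ℝ) ≤ N := by exact_mod_cast hRN
  have hlog : 0 < Real.log N := Real.log_pos (by linarith)
  have h1 : 2 * ((N : ℝ) * R + 1) ≤ (N : ℝ) ^ 3 := by
    have : (N : ℝ) * R ≤ N * N := by gcongr
    nlinarith
  calc (2 * ((N : ℝ) * R + 1)) ^ D ≤ ((N : ℝ) ^ 3) ^ D := by gcongr
    _ = Real.exp (D * (3 * Real.log N)) := by
        rw [Real.exp_nat_mul]
        congr 1
        rw [show (3 : ℝ) = (3 : ℕ) by norm_num, Real.exp_nat_mul, Real.exp_log (by linarith)]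
    _ ≤ Real.exp (x / 8) := by
        rw [le_div_iff₀ (by positivity)] at hD
        exact Real.exp_le_exp.2 (by linarith)

lemma two_mul_le_ceil_mul_rpow {k : ℕ} (hk : 3 ≤ k) :
    2 * k ≤ ⌈(20 : ℝ) * (2 * (k : ℝ)) ^ ((k : ℝ) / 2)⌉₊ := by
  have hk0 : (3 : ℝ) ≤ k := by exact_mod_cast hk
  have h1 : 2 * (k : ℝ) ≤ (2 * (k : ℝ)) ^ ((k : ℝ) / 2) :=
    Real.self_le_rpow_of_one_le (by linarith) (by linarith)
  have h2 := Nat.le_ceil ((20 : ℝ) * (2 * (k : ℝ)) ^ ((k : ℝ) / 2))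
  have h3 : ((2 * k : ℕ) : ℝ) ≤ ⌈(20 : ℝ) * (2 * (k : ℝ)) ^ ((k : ℝ) / 2)⌉₊ := by
    push_cast
    linarith
  exact_mod_cast h3

theorem stmt12 (k : ℕ) (hk : 3 ≤ k) (γ : ℝ) (hγ0 : 0 < γ) (hγ : γ < 1 / 4 ^ (k - 1)) :
    ∃ c : ℝ, 0 < c ∧ ∃ R₀ : ℕ, ∀ R : ℕ, R₀ ≤ R →
      ∀ N : ℕ, N = ⌈(20 : ℝ) * (2 * (k : ℝ)) ^ ((k : ℝ) / 2)⌉₊ * R →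
      ∃ ζ : (Fin R → Fin N → Bool) → ℝ,
        -- (i) no support on inputs of Hamming weight larger than N
        (∀ x : Fin R → Fin N → Bool, N < wt2 x → ζ x = 0) ∧
        -- (ii) high correlation with f on inputs of Hamming weight at most N
        (2 / 3 <
          (∑ x ∈ Finset.univ.filter
              (fun x : Fin R → Fin N → Bool => inDom γ N R k x ∧ wt2 x ≤ N),
            ζ x * fval N R k x)
          - ∑ x ∈ Finset.univ.filter
              (fun x : Fin R → Fin N → Bool => ¬ inDom γ N R k x ∧ wt2 x ≤ N),
            |ζ x|) ∧
        -- (iii) normalization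
        (∑ x : Fin R → Fin N → Bool, |ζ x| = 1) ∧
        -- (iv) pure high degree at least c·√(N^{1−1/k})/(ln N)²
        (∀ p : MvPolynomial (Fin R × Fin N) ℝ,
          (p.totalDegree : ℝ) <
            c * Real.sqrt ((N : ℝ) ^ ((1 : ℝ) - 1 / (k : ℝ))) / (Real.log N) ^ 2 →
          ∑ x : Fin R → Fin N → Bool,
            MvPolynomial.eval (fun ij => toSign (x ij.1 ij.2)) p * ζ x = 0) := by
  obtain ⟨B, hBdef⟩ : ∃ B : ℝ, B = 2000 * (k.factorial * 2 ^ (k + 2)) := ⟨_, rfl⟩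
  have hB : 0 < B := by
    rw [hBdef]
    positivity
  obtain ⟨A, hAdef⟩ : ∃ A : ℝ, A = Real.sqrt (2 * B ^ (1 / (k : ℝ))) := ⟨_, rfl⟩
  have hA0 : 0 < A := by
    rw [hAdef]
    positivity
  have hA : A ^ 2 = 2 * B ^ (1 / (k : ℝ)) := by rw [hAdef, Real.sq_sqrt (by positivity)]
  have hγ' : 2 * γ ≤ 1 / 2 ^ k := by
    have h1 : (2 : ℝ) ^ (k + 1) ≤ 4 ^ (k - 1) := by
      rw [show (4 : ℝ) = 2 ^ 2 by norm_num, ← pow_mul]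
      exact pow_le_pow_right₀ one_le_two (by omega)
    have h2 : 1 / (4 : ℝ) ^ (k - 1) ≤ 1 / 2 ^ (k + 1) :=
      one_div_le_one_div_of_le (by positivity) h1
    have h3 : 2 * (1 / (2 : ℝ) ^ (k + 1)) = 1 / 2 ^ k := by
      rw [pow_succ]
      field_simp
    linarith
  obtain ⟨R₀, hR₀⟩ := Filter.eventually_atTop.1
    (eventually_parameters_large k hk (A := A) hγ0 hB)
  refine ⟨1 / (48 * A), by positivity, R₀, fun R hR N hN => ?_⟩
  obtain ⟨hR3, hγR, hBR, hk2, hs⟩ := hR₀ R hR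
  have hC := two_mul_le_ceil_mul_rpow hk
  have hkR : 2 * (k * R) ≤ N := by
    rw [hN, ← mul_assoc]
    exact Nat.mul_le_mul_right R hC
  have hRN : R ≤ N := by nlinarith
  obtain ⟨a, d, ha, haB, had, hd, hy⟩ :=
    exists_parameters hk hB hA0 hA hBR hRN (by omega) hk2 hs
  have hN3 : (3 : ℝ) ≤ N := by exact_mod_cast hR3.trans hRN
  have hlog : 1 ≤ Real.log N := by
    rw [Real.le_log_iff_exp_le (by linarith)]
    linarith [Real.exp_one_lt_d9]
  have hR0 : (3 : ℝ) ≤ R := by exact_mod_cast hR3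
  have ha0 : (0 : ℝ) < a := by
    have : 0 < a := by omega
    exact_mod_cast this
  have hD : ((⌊(d : ℝ) / (24 * Real.log N)⌋₊ : ℕ) : ℝ) ≤ d / (24 * Real.log N) :=
    Nat.floor_le (by positivity)
  have hDd : ⌊(d : ℝ) / (24 * Real.log N)⌋₊ ≤ d := by
    have : (d : ℝ) / (24 * Real.log N) ≤ d := div_le_self (by positivity) (by linarith)
    exact_mod_cast hD.trans this
  have hdN : d ≤ N := by nlinarith
  obtain ⟨ζ, h1, h2, h3, h4⟩ := exists_dual_witness (δ := 1 / (2000 * R)) hk hγ' hγR ha had hkR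
    (by
      rw [div_le_div_iff₀ (by positivity) (by positivity)]
      rw [hBdef] at haB
      linarith)
    (by
      rw [div_le_one (by positivity)]
      linarith)
    (by
      field_simp
      exact le_rfl)
    hd hDd (hDd.trans hdN) (pow_le_exp_of_le_div_log (hR3.trans hRN) hRN hD)
  refine ⟨ζ, h1, h2, h3, fun p hp => h4.sum_eval_mul_eq_zero p (Nat.le_floor (hp.le.trans ?_))⟩
  rw [div_le_div_iff₀ (by positivity) (by positivity)]
  have e : 1 / (48 * A) * Real.sqrt ((N : ℝ) ^ ((1 : ℝ) - 1 / (k : ℝ))) ≤ d / 24 := by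
    rw [one_div, inv_mul_le_iff₀ (by positivity)]
    linarith
  calc _ ≤ d / 24 * (24 * Real.log N) := by gcongr
    _ = d * Real.log N := by ring
    _ ≤ d * Real.log N ^ 2 := by
      gcongr
      nlinarith
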